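/- The weight-2 Hodge structure on ∧²V is simple: every sub-Hodge structure of ∧²V, i.e. every ℚ-subspace H ⊆ ∧²V such that ℂ ⊗ H is the direct sum of its intersections with the (2,0)-, (1,1)- and (0,2)-components of ∧²V_ℂ, is either 0 or all of ∧²V. -/

import Mathlib

open scoped TensorProduct

noncomputable section

namespace VoisinPaper

/-- The splitting field of a polynomial with roots `lam 0, …, lam (m-1)`, realized as the
subfield of `ℂ` generated by the roots. -/
def splittingFieldOfRoots (m : ℕ) (lam : Fin m → ℂ) : IntermediateField ℚ ℂ :=
  IntermediateField.adjoin ℚ (Set.range lam)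

lemma root_mem_splittingFieldOfRoots (m : ℕ) (lam : Fin m → ℂ) (i : Fin m) :
    lam i ∈ splittingFieldOfRoots m lam :=
  IntermediateField.subset_adjoin ℚ _ ⟨i, rfl⟩

/-- Condition (*): the Galois group of the splitting field of the roots over `ℚ` acts on the
set of roots as the full symmetric group on `m` letters. -/
def galoisActsFully (m : ℕ) (lam : Fin m → ℂ) : Prop :=
  ∀ τ : Equiv.Perm (Fin m),
    ∃ σ : (splittingFieldOfRoots m lam) ≃ₐ[ℚ] (splittingFieldOfRoots m lam),
      ∀ i, (σ ⟨lam i, root_mem_splittingFieldOfRoots m lam i⟩ : ℂ) = lam (τ i)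

/-- The canonical map `V → ℂ ⊗_ℚ V`, `v ↦ 1 ⊗ v`. -/
def iotaV (V : Type) [AddCommGroup V] [Module ℚ V] : V →ₗ[ℚ] ℂ ⊗[ℚ] V :=
  TensorProduct.mk ℚ ℂ V 1

/-- The conjugation of `ℂ ⊗_ℚ V`: the `ℂ`-antilinear involution fixing `1 ⊗ V`. -/
def conjV (V : Type) [AddCommGroup V] [Module ℚ V] : ℂ ⊗[ℚ] V →ₗ[ℚ] ℂ ⊗[ℚ] V :=
  TensorProduct.map ((Complex.conjAe.toLinearMap).restrictScalars ℚ) LinearMap.id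

/-- The image `c(W)` of a subspace `W ⊆ ℂ ⊗_ℚ V` under the conjugation. -/
def conjSub (V : Type) [AddCommGroup V] [Module ℚ V] (W : Submodule ℂ (ℂ ⊗[ℚ] V)) :
    Submodule ℚ (ℂ ⊗[ℚ] V) :=
  Submodule.map (conjV V) (W.restrictScalars ℚ)

/-- The `(p, k-p)` Hodge component of `⋀^k (ℂ ⊗ V)` (sitting inside the exterior algebra of
`ℂ ⊗ V`): the `ℂ`-span of wedge products of `p` elements of `W` and `k - p` elements of
`c(W)`; this is the image of `⋀^p W ⊗ ⋀^{k-p} c(W)` under the wedge product. -/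
def hodgeComp (V : Type) [AddCommGroup V] [Module ℚ V] (W : Submodule ℂ (ℂ ⊗[ℚ] V))
    (k p : ℕ) : Submodule ℂ (ExteriorAlgebra ℂ (ℂ ⊗[ℚ] V)) :=
  Submodule.span ℂ {x | ∃ v : Fin k → ℂ ⊗[ℚ] V,
     (∀ i : Fin k, ((i : ℕ) < p → v i ∈ W) ∧ (p ≤ (i : ℕ) → v i ∈ conjSub V W)) ∧
     x = ExteriorAlgebra.ιMulti ℂ k v}

/-- The natural "complexification" morphism from the exterior algebra of `V` over `ℚ` to the
exterior algebra of `ℂ ⊗ V` over `ℂ`; it identifies `⋀^k_ℚ V` with the rational points of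
`⋀^k_ℂ (ℂ ⊗ V)`. -/
def thetaA (V : Type) [AddCommGroup V] [Module ℚ V]
    [Algebra ℚ (ExteriorAlgebra ℂ (ℂ ⊗[ℚ] V))]
    [IsScalarTower ℚ ℂ (ExteriorAlgebra ℂ (ℂ ⊗[ℚ] V))] :
    ExteriorAlgebra ℚ V →ₐ[ℚ] ExteriorAlgebra ℂ (ℂ ⊗[ℚ] V) :=
  ExteriorAlgebra.lift ℚ
    ⟨((ExteriorAlgebra.ι ℂ (M := ℂ ⊗[ℚ] V)).restrictScalars ℚ) ∘ₗ iotaV V,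
      fun _ => ExteriorAlgebra.ι_sq_zero _⟩

lemma exists_coeffs (m : ℕ) (lam : Fin m → ℂ) (hinj : Function.Injective lam)
    (hgal : galoisActsFully m lam) :
    ∃ c : Fin m → ℕ → splittingFieldOfRoots m lam,
      (∀ τ : Equiv.Perm (Fin m), ∃ σ : (splittingFieldOfRoots m lam) ≃ₐ[ℚ]
        (splittingFieldOfRoots m lam), ∀ i k, σ (c i k) = c (τ i) k) ∧
      ∀ i j, ∑ k ∈ Finset.range m, (c i k : ℂ) * lam j ^ k = if i = j then 1 else 0 := by
  classical
  set K := splittingFieldOfRoots m lam with hK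
  let lK : Fin m → K := fun i => ⟨lam i, root_mem_splittingFieldOfRoots m lam i⟩
  have hlK : Function.Injective lK := fun i j h => hinj (congrArg Subtype.val h)
  refine ⟨fun i k => (Lagrange.basis Finset.univ lK i).coeff k, ?_, ?_⟩
  · intro τ
    obtain ⟨σ, hσ⟩ := hgal τ
    refine ⟨σ, fun i k => ?_⟩
    have h1 : ∀ i, σ (lK i) = lK (τ i) := fun i => Subtype.ext (hσ i)
    have h2 : (Lagrange.basis Finset.univ lK i).map (σ : K →+* K)
        = Lagrange.basis Finset.univ lK (τ i) := by
      simp only [Lagrange.basis, Polynomial.map_prod, Lagrange.basisDivisor, Polynomial.map_mul,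
        Polynomial.map_sub, Polynomial.map_C, Polynomial.map_X]
      refine Finset.prod_equiv τ ?_ ?_
      · intro j; simp
      · intro j _
        simp [h1]
    show σ ((Lagrange.basis Finset.univ lK i).coeff k) = (Lagrange.basis Finset.univ lK (τ i)).coeff k
    rw [← h2, Polynomial.coeff_map]
    rfl
  · intro i j
    have h3 : (Lagrange.basis Finset.univ lK i).natDegree < m := by
      rw [Lagrange.natDegree_basis hlK.injOn (Finset.mem_univ i)]
      have := i.pos
      simp; omega
    have h4 : (Lagrange.basis Finset.univ lK i).eval (lK j) = if i = j then 1 else 0 := by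
      split_ifs with h
      · subst h; exact Lagrange.eval_basis_self hlK.injOn (Finset.mem_univ i)
      · exact Lagrange.eval_basis_of_ne h (Finset.mem_univ j)
    rw [Polynomial.eval_eq_sum_range' h3] at h4
    have h5 := congrArg (fun x : K => (x : ℂ)) h4
    push_cast at h5
    rw [h5]
    split_ifs <;> simp

lemma exists_dual_ext {m : ℕ} (l : Matrix (Fin m) (Fin m) ℚ →ₗ[ℚ] ℚ) :
    ∃ lc : Matrix (Fin m) (Fin m) ℂ →ₗ[ℂ] ℂ,
      ∀ q : Matrix (Fin m) (Fin m) ℚ, lc ((algebraMap ℚ ℂ).mapMatrix q) = (l q : ℂ) := by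
  refine ⟨∑ a, ∑ b, (l (Matrix.single a b 1) : ℂ) • Matrix.entryLinearMap ℂ ℂ a b, fun q => ?_⟩
  conv_rhs => rw [Matrix.matrix_eq_sum_single q]
  simp only [map_sum, LinearMap.sum_apply, LinearMap.smul_apply]
  push_cast
  refine Finset.sum_congr rfl fun a _ => Finset.sum_congr rfl fun b _ => ?_
  have : Matrix.single a b (q a b) = q a b • Matrix.single a b (1:ℚ) := by simp
  rw [this, map_smul]
  simp [mul_comm]

lemma matrix_core (m : ℕ) (A : Matrix (Fin m) (Fin m) ℚ) (lam : Fin m → ℂ)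
    (hinj : Function.Injective lam) (hgal : galoisActsFully m lam)
    (E E' : Matrix (Fin m) (Fin m) ℂ) (hEE' : E * E' = 1) (hE'E : E' * E = 1)
    (hdiag : (algebraMap ℚ ℂ).mapMatrix A * E = E * Matrix.diagonal lam)
    (S : Finset (Fin m)) (hS : S.Nonempty) (hS' : ∃ j, j ∉ S)
    (H : Submodule ℚ (Matrix (Fin m) (Fin m) ℚ))
    (hskew : ∀ h ∈ H, h.transpose = -h)
    (hstab : ∀ h ∈ H,
      (E * Matrix.diagonal (fun i => if i ∈ S then 1 else 0) * E') *
          (algebraMap ℚ ℂ).mapMatrix h +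
        (algebraMap ℚ ℂ).mapMatrix h *
          (E * Matrix.diagonal (fun i => if i ∈ S then 1 else 0) * E').transpose ∈
        Submodule.span ℂ ((algebraMap ℚ ℂ).mapMatrix '' (H : Set (Matrix (Fin m) (Fin m) ℚ)))) :
    H = ⊥ ∨ ∀ s : Matrix (Fin m) (Fin m) ℚ, s.transpose = -s → s ∈ H := by
  classical
  obtain ⟨c, hc, hlag⟩ := exists_coeffs m lam hinj hgal
  set R := (algebraMap ℚ ℂ).mapMatrix (m := Fin m) with hR
  have hRT : ∀ q, (R q).transpose = R q.transpose := fun q => rfl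
  have hRinj : Function.Injective R := by
    intro x y h
    ext a b
    have := congrFun (congrFun h a) b
    simpa [hR] using this
  -- powers
  have hpow : ∀ k, R (A ^ k) = E * Matrix.diagonal (fun i => lam i ^ k) * E' := by
    intro k
    have h1 : R A = E * Matrix.diagonal lam * E' := by
      rw [← hdiag, Matrix.mul_assoc, hEE', Matrix.mul_one]
    induction k with
    | zero => simp [hEE']
    | succ k ih =>
      rw [pow_succ, map_mul, ih, h1]
      calc _ = E * Matrix.diagonal (fun i => lam i ^ k) * (E' * E) * Matrix.diagonal lam * E' := by
            simp only [Matrix.mul_assoc]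
        _ = _ := by
            rw [hE'E, Matrix.mul_one, Matrix.mul_assoc E, Matrix.diagonal_mul_diagonal]
            simp only [pow_succ]
  let P : Fin m → Matrix (Fin m) (Fin m) ℂ := fun i => E * Matrix.single i i 1 * E'
  have hPent : ∀ i, P i = Matrix.vecMulVec (fun a => E a i) (fun b => E' i b) := by
    intro i
    ext a b
    simp [P, Matrix.mul_apply, Matrix.vecMulVec, Matrix.single_apply, ite_and]
  have hdiagsum : ∀ d : Fin m → ℂ, E * Matrix.diagonal d * E' = ∑ i, d i • P i := by
    intro d
    have : Matrix.diagonal d = ∑ i, d i • Matrix.single i i (1:ℂ) := by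
      ext a b
      simp [Matrix.sum_apply, Matrix.single_apply, Matrix.diagonal_apply, ite_and]
    rw [this, Finset.mul_sum, Finset.sum_mul]
    simp only [P, Matrix.mul_smul, Matrix.smul_mul]
  have hPc : ∀ i, P i = ∑ k ∈ Finset.range m, (c i k : ℂ) • R (A ^ k) := by
    intro i
    have h1 : ∑ k ∈ Finset.range m, (c i k : ℂ) • R (A ^ k) =
        E * Matrix.diagonal (fun j => ∑ k ∈ Finset.range m, (c i k : ℂ) * lam j ^ k) * E' := by
      rw [hdiagsum]
      simp only [hpow, hdiagsum, Finset.smul_sum, Finset.sum_smul, smul_smul]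
      rw [Finset.sum_comm]
    rw [h1, hdiagsum]
    simp [hlag]
  have hPone : ∑ i, P i = 1 := by
    have := hdiagsum (fun _ => 1)
    simpa [hEE'] using this.symm
  have hPP : ∀ i j, i ≠ j → P i * P j = 0 := by
    intro i j hij
    simp only [P]
    calc _ = E * Matrix.single i i 1 * (E' * E) * Matrix.single j j 1 * E' := by
            simp only [Matrix.mul_assoc]
      _ = 0 := by
        rw [hE'E, Matrix.mul_one, Matrix.mul_assoc E, Matrix.single_mul_single_of_ne _ _ _ _ hij]
        simp
  -- Galois transfer
  have gal1 : ∀ (q : ℕ → ℚ) (T : Finset (Fin m)),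
      ∑ i ∈ T, ∑ k ∈ Finset.range m, (c i k : ℂ) * (q k : ℂ) = 0 →
      ∀ τ : Equiv.Perm (Fin m),
        ∑ i ∈ T, ∑ k ∈ Finset.range m, (c (τ i) k : ℂ) * (q k : ℂ) = 0 := by
    intro q T h τ
    obtain ⟨σ, hσ⟩ := hc τ
    have h1 : ∑ i ∈ T, ∑ k ∈ Finset.range m, c i k * (q k : splittingFieldOfRoots m lam) = 0 := by
      apply Subtype.val_injective
      push_cast
      simpa using h
    have h2 := congrArg σ h1
    simp only [map_sum, map_mul, hσ, map_ratCast, map_zero] at h2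
    have h3 := congrArg (fun x : splittingFieldOfRoots m lam => (x : ℂ)) h2
    push_cast at h3
    simpa using h3
  have gal2 : ∀ (q : ℕ → ℕ → ℚ) (i j : Fin m),
      ∑ k ∈ Finset.range m, ∑ l ∈ Finset.range m, (c i k : ℂ) * (c j l : ℂ) * (q k l : ℂ) = 0 →
      ∀ τ : Equiv.Perm (Fin m),
      ∑ k ∈ Finset.range m, ∑ l ∈ Finset.range m,
        (c (τ i) k : ℂ) * (c (τ j) l : ℂ) * (q k l : ℂ) = 0 := by
    intro q i j h τ
    obtain ⟨σ, hσ⟩ := hc τ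
    have h1 : ∑ k ∈ Finset.range m, ∑ l ∈ Finset.range m,
        c i k * c j l * (q k l : splittingFieldOfRoots m lam) = 0 := by
      apply Subtype.val_injective
      push_cast
      simpa using h
    have h2 := congrArg σ h1
    simp only [map_sum, map_mul, hσ, map_ratCast, map_zero] at h2
    have h3 := congrArg (fun x : splittingFieldOfRoots m lam => (x : ℂ)) h2
    push_cast at h3
    simpa using h3
  -- step 1 : stability over ℂ under all functionals
  have key1 : ∀ (l : Matrix (Fin m) (Fin m) ℚ →ₗ[ℚ] ℚ)
      (lc : Matrix (Fin m) (Fin m) ℂ →ₗ[ℂ] ℂ), (∀ q, lc (R q) = (l q : ℂ)) →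
      (∀ h ∈ H, l h = 0) → ∀ h ∈ H, ∀ i, lc (P i * R h + R h * (P i).transpose) = 0 := by
    intro l lc hl hlH h hh
    have hspan : ∀ x ∈ Submodule.span ℂ (R '' (H : Set (Matrix (Fin m) (Fin m) ℚ))), lc x = 0 := by
      intro x hx
      have : Submodule.span ℂ (R '' (H : Set (Matrix (Fin m) (Fin m) ℚ))) ≤ LinearMap.ker lc := by
        rw [Submodule.span_le]
        rintro _ ⟨y, hy, rfl⟩
        simp [hl, hlH y hy]
      exact this hx
    let u : Fin m → ℂ := fun i => lc (P i * R h + R h * (P i).transpose)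
    have hu : ∀ i, u i = ∑ k ∈ Finset.range m, (c i k : ℂ) *
        ((l (A ^ k * h + h * (A ^ k).transpose) : ℚ) : ℂ) := by
      intro i
      simp only [u]
      rw [hPc i]
      simp only [Matrix.transpose_sum, Matrix.transpose_smul, Finset.sum_mul, Finset.mul_sum,
        ← Finset.sum_add_distrib, map_sum, Matrix.smul_mul, Matrix.mul_smul, ← smul_add, map_smul,
        hRT, ← map_mul, ← map_add, hl, smul_eq_mul]
    have h0 : ∑ i ∈ S, u i = 0 := by
      have := hspan _ (hstab h hh)
      rw [hdiagsum] at this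
      simp only [ite_smul, one_smul, zero_smul, Finset.sum_ite_mem, Finset.univ_inter] at this
      rw [← this, Matrix.transpose_sum, Finset.sum_mul, Finset.mul_sum, ← Finset.sum_add_distrib,
        map_sum]
    have h1 : ∀ τ : Equiv.Perm (Fin m), ∑ i ∈ S, u (τ i) = 0 := by
      intro τ
      simp only [hu] at h0 ⊢
      exact gal1 _ S h0 τ
    have h2 : ∀ i ∈ S, ∀ j, j ∉ S → u i = u j := by
      intro i hi j hj
      have h3 := h1 (Equiv.swap i j)
      rw [← Finset.add_sum_erase S _ hi] at h0 h3
      rw [Equiv.swap_apply_left] at h3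
      have h4 : ∑ x ∈ S.erase i, u (Equiv.swap i j x) = ∑ x ∈ S.erase i, u x := by
        refine Finset.sum_congr rfl fun x hx => ?_
        rw [Equiv.swap_apply_of_ne_of_ne (Finset.ne_of_mem_erase hx)]
        rintro rfl
        exact hj (Finset.mem_of_mem_erase hx)
      rw [h4] at h3
      exact add_right_cancel (h0.trans h3.symm)
    obtain ⟨j0, hj0⟩ := hS'
    have h5 : u j0 = 0 := by
      rw [Finset.sum_congr rfl (fun i hi => h2 i hi j0 hj0)] at h0
      simp only [Finset.sum_const, nsmul_eq_mul, mul_eq_zero, Nat.cast_eq_zero,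
        Finset.card_eq_zero] at h0
      exact h0.resolve_left hS.ne_empty
    obtain ⟨i0, hi0⟩ := hS
    intro i
    show u i = 0
    by_cases hi : i ∈ S
    · rw [h2 i hi j0 hj0, h5]
    · rw [← h2 i0 hi0 i hi, h2 i0 hi0 j0 hj0, h5]
  have hstabQ : ∀ h ∈ H, ∀ k, A ^ k * h + h * (A ^ k).transpose ∈ H := by
    intro h hh k
    by_contra hcon
    obtain ⟨l, hl0, hlH⟩ := Submodule.exists_le_ker_of_notMem hcon
    obtain ⟨lc, hlc⟩ := exists_dual_ext l
    rw [← hR] at hlc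
    apply hl0
    have h1 := key1 l lc hlc (fun h hh => hlH hh) h hh
    have h2 : (l (A ^ k * h + h * (A ^ k).transpose) : ℂ) = 0 := by
      rw [← hlc, map_add, map_mul, map_mul, ← hRT]
      rw [hpow, hdiagsum]
      simp only [Matrix.transpose_sum, Matrix.transpose_smul, Finset.sum_mul, Finset.mul_sum,
        ← Finset.sum_add_distrib, map_sum, Matrix.smul_mul, Matrix.mul_smul, ← smul_add, map_smul,
        h1, smul_zero, Finset.sum_const_zero]
    exact_mod_cast h2
  -- step 2
  have hw : ∀ (M : Matrix (Fin m) (Fin m) ℂ) (i j), P i * M * (P j).transpose =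
      ((fun b => E' i b) ⬝ᵥ (M.mulVec (fun b => E' j b))) •
        Matrix.vecMulVec (fun a => E a i) (fun a => E a j) := by
    intro M i j
    rw [hPent, hPent, Matrix.transpose_vecMulVec, Matrix.vecMulVec_mul, Matrix.vecMulVec_mul_vecMulVec,
      Matrix.dotProduct_mulVec, Matrix.vecMulVec_smul]
  have hquadskew : ∀ (s : Matrix (Fin m) (Fin m) ℚ), s.transpose = -s → ∀ x y : Fin m → ℂ,
      x ⬝ᵥ ((R s).mulVec y) = - (y ⬝ᵥ ((R s).mulVec x)) := by
    intro s hs x y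
    rw [Matrix.dotProduct_mulVec, ← Matrix.mulVec_transpose, hRT, hs, map_neg, Matrix.neg_mulVec,
      neg_dotProduct, dotProduct_comm]
  have hsum : ∀ M : Matrix (Fin m) (Fin m) ℂ, M = ∑ i, ∑ j, P i * M * (P j).transpose := by
    intro M
    have h1 : M = (∑ i, P i) * M * (∑ j, P j).transpose := by simp [hPone]
    conv_lhs => rw [h1]
    simp only [Matrix.transpose_sum, Finset.sum_mul, Finset.mul_sum]
    rw [Finset.sum_comm]
  by_cases hH : H = ⊥
  · exact Or.inl hH
  right
  obtain ⟨h, hh, hne⟩ := (Submodule.ne_bot_iff H).1 hH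
  -- all components nonzero
  have hex : ∃ i j, i ≠ j ∧ P i * R h * (P j).transpose ≠ 0 := by
    by_contra hcon
    push Not at hcon
    apply hne
    apply hRinj
    rw [map_zero, hsum (R h)]
    refine Finset.sum_eq_zero fun i _ => Finset.sum_eq_zero fun j _ => ?_
    by_cases hij : i = j
    · subst hij
      rw [hw]
      have := hquadskew h (hskew h hh) (fun b => E' i b) (fun b => E' i b)
      rw [self_eq_neg.1 this, zero_smul]
    · exact hcon i j hij
  have hall : ∀ i j, i ≠ j → P i * R h * (P j).transpose ≠ 0 := by
    obtain ⟨i0, j0, hij0, hw0⟩ := hex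
    intro i j hij hz
    apply hw0
    obtain ⟨τ, hτi, hτj⟩ : ∃ τ : Equiv.Perm (Fin m), τ i = i0 ∧ τ j = j0 := by
      refine ⟨(Equiv.swap i i0).trans (Equiv.swap (Equiv.swap i i0 j) j0), ?_, ?_⟩
      · simp only [Equiv.trans_apply, Equiv.swap_apply_left]
        refine Equiv.swap_apply_of_ne_of_ne ?_ hij0
        intro h'
        apply hij
        apply (Equiv.swap i i0).injective
        rw [← h', Equiv.swap_apply_left]
      · simp
    have hent : ∀ i j a b, (P i * R h * (P j).transpose) a b =
        ∑ k ∈ Finset.range m, ∑ l ∈ Finset.range m, (c i k : ℂ) * (c j l : ℂ) *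
          (((A ^ k * h * (A ^ l).transpose) a b : ℚ) : ℂ) := by
      intro i j a b
      rw [hPc i, hPc j]
      simp only [Matrix.transpose_sum, Matrix.transpose_smul, Finset.sum_mul, Finset.mul_sum,
        Matrix.smul_mul, Matrix.mul_smul, hRT, ← map_mul, Matrix.sum_apply, Matrix.smul_apply,
        smul_eq_mul]
      rw [Finset.sum_comm]
      refine Finset.sum_congr rfl fun k _ => Finset.sum_congr rfl fun l _ => ?_
      simp only [hR, RingHom.mapMatrix_apply, Matrix.map_apply, eq_ratCast]
      ring
    ext a b
    have h1 : (P i * R h * (P j).transpose) a b = 0 := by rw [hz]; rfl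
    rw [hent] at h1
    have h2 := gal2 (fun k l => (A ^ k * h * (A ^ l).transpose) a b) i j h1 τ
    rw [hτi, hτj] at h2
    rw [hent, h2]; rfl
  intro s hs
  by_contra hcon
  obtain ⟨l, hl0, hlH⟩ := Submodule.exists_le_ker_of_notMem hcon
  obtain ⟨lc, hlc⟩ := exists_dual_ext l
  apply hl0
  have hlH' : ∀ h ∈ H, l h = 0 := fun h hh => hlH hh
  have key2 : ∀ i j, i ≠ j →
      lc (P i * R h * (P j).transpose + P j * R h * (P i).transpose) = 0 := by
    intro i j hij
    have h1 : ∀ k, lc (P i * R (A ^ k * h + h * (A ^ k).transpose) +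
        R (A ^ k * h + h * (A ^ k).transpose) * (P i).transpose) = 0 :=
      fun k => key1 l lc hlc hlH' _ (hstabQ h hh k) i
    have h2 : P i * R h * (P j).transpose + P j * R h * (P i).transpose =
        P i * (P j * R h + R h * (P j).transpose) +
          (P j * R h + R h * (P j).transpose) * (P i).transpose := by
      rw [Matrix.mul_add, Matrix.add_mul, ← Matrix.mul_assoc, hPP i j hij,
        Matrix.mul_assoc (R h) (P j).transpose, ← Matrix.transpose_mul, hPP i j hij]
      simp [Matrix.mul_assoc]
    have h3 : P j * R h + R h * (P j).transpose =
        ∑ k ∈ Finset.range m, (c j k : ℂ) • R (A ^ k * h + h * (A ^ k).transpose) := by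
      rw [hPc j]
      simp only [Matrix.transpose_sum, Matrix.transpose_smul, Finset.sum_mul, Finset.mul_sum,
        ← Finset.sum_add_distrib, Matrix.smul_mul, Matrix.mul_smul, ← smul_add,
        hRT, ← map_mul, ← map_add]
    rw [h2, h3]
    simp only [Finset.sum_mul, Finset.mul_sum, ← Finset.sum_add_distrib, Matrix.smul_mul,
      Matrix.mul_smul, ← smul_add, map_sum, map_smul, h1]
    simp
  have key3 : ∀ i j, lc (Matrix.vecMulVec (fun a => E a i) (fun a => E a j)) =
      lc (Matrix.vecMulVec (fun a => E a j) (fun a => E a i)) := by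
    intro i j
    by_cases hij : i = j
    · rw [hij]
    have h1 := key2 i j hij
    have h2 := hall i j hij
    rw [hw, hw, hquadskew h (hskew h hh) (fun b => E' j b) (fun b => E' i b), neg_smul,
      ← sub_eq_add_neg, ← smul_sub, map_smul, smul_eq_mul, mul_eq_zero] at h1
    rw [hw] at h2
    have h3 := h1.resolve_left (fun h0 => h2 (by rw [h0, zero_smul]))
    rw [map_sub] at h3
    exact sub_eq_zero.1 h3
  have h1 : (l s : ℂ) = - (l s : ℂ) := by
    rw [← hlc]
    conv_lhs => rw [hsum (R s)]
    conv_rhs => rw [hsum (R s), Finset.sum_comm]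
    simp only [map_sum, ← Finset.sum_neg_distrib]
    refine Finset.sum_congr rfl fun i _ => Finset.sum_congr rfl fun j _ => ?_
    rw [hw, hw, hquadskew s hs (fun b => E' j b) (fun b => E' i b), map_smul, map_smul, key3 i j,
      neg_smul, neg_neg]
  have h2 := self_eq_neg.1 h1
  exact_mod_cast h2

/-- The alternating map `(x, y) ↦ x yᵀ - y xᵀ` in coordinates. -/
def altCoord {F M : Type*} [Field F] [AddCommGroup M] [Module F M] {m : ℕ}
    (b : Module.Basis (Fin m) F M) : M [⋀^Fin 2]→ₗ[F] Matrix (Fin m) (Fin m) F where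
  toFun v := Matrix.vecMulVec (b.repr (v 0)) (b.repr (v 1)) -
    Matrix.vecMulVec (b.repr (v 1)) (b.repr (v 0))
  map_update_add' v i x y := by
    ext a c
    fin_cases i <;> simp [Matrix.vecMulVec_apply, Function.update] <;> ring
  map_update_smul' v i r x := by
    ext a c
    fin_cases i <;> simp [Matrix.vecMulVec_apply, Function.update] <;> ring
  map_eq_zero_of_eq' v i j h hij := by
    have : v 0 = v 1 := by
      fin_cases i <;> fin_cases j <;> simp_all
    simp [this]

/-- Coordinates on the exterior square. -/
def coord2 {F M : Type*} [Field F] [AddCommGroup M] [Module F M] {m : ℕ}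
    (b : Module.Basis (Fin m) F M) : ExteriorAlgebra F M →ₗ[F] Matrix (Fin m) (Fin m) F :=
  ExteriorAlgebra.liftAlternating (fun k => match k with
    | 2 => altCoord b
    | _ => 0)

lemma coord2_apply {F M : Type*} [Field F] [AddCommGroup M] [Module F M] {m : ℕ}
    (b : Module.Basis (Fin m) F M) (v : Fin 2 → M) :
    coord2 b (ExteriorAlgebra.ιMulti F 2 v) =
      Matrix.vecMulVec (b.repr (v 0)) (b.repr (v 1)) -
        Matrix.vecMulVec (b.repr (v 1)) (b.repr (v 0)) := by
  rw [coord2, ExteriorAlgebra.liftAlternating_apply_ιMulti]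
  rfl

lemma iotaMulti_two {F M : Type*} [Field F] [AddCommGroup M] [Module F M] (v : Fin 2 → M) :
    ExteriorAlgebra.ιMulti F 2 v = ExteriorAlgebra.ι F (v 0) * ExteriorAlgebra.ι F (v 1) := by
  simp [ExteriorAlgebra.ιMulti_apply]
  rfl

lemma coord2_skew {F M : Type*} [Field F] [AddCommGroup M] [Module F M] {m : ℕ}
    (b : Module.Basis (Fin m) F M) (x : ExteriorAlgebra F M) (hx : x ∈ ⋀[F]^2 M) :
    (coord2 b x).transpose = - coord2 b x := by
  rw [← ExteriorAlgebra.ιMulti_span_fixedDegree] at hx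
  induction hx using Submodule.span_induction with
  | mem x h =>
    obtain ⟨v, rfl⟩ := h
    rw [coord2_apply]
    simp [Matrix.transpose_vecMulVec]
  | zero => simp
  | add x y _ _ hx hy => rw [map_add, Matrix.transpose_add, hx, hy]; abel
  | smul a x _ hx => rw [map_smul, Matrix.transpose_smul, hx, smul_neg]

lemma coord2_recon {F M : Type*} [Field F] [AddCommGroup M] [Module F M] {m : ℕ}
    (b : Module.Basis (Fin m) F M) (x : ExteriorAlgebra F M) (hx : x ∈ ⋀[F]^2 M) :
    (2 : F) • x = ∑ i, ∑ j, coord2 b x i j •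
      (ExteriorAlgebra.ι F (b i) * ExteriorAlgebra.ι F (b j)) := by
  rw [← ExteriorAlgebra.ιMulti_span_fixedDegree] at hx
  induction hx using Submodule.span_induction with
  | mem x h =>
    obtain ⟨v, rfl⟩ := h
    rw [coord2_apply, iotaMulti_two]
    have hexp : ∀ x y : M, ExteriorAlgebra.ι F x * ExteriorAlgebra.ι F y =
        ∑ i, ∑ j, (b.repr x i * b.repr y j) •
          (ExteriorAlgebra.ι F (b i) * ExteriorAlgebra.ι F (b j)) := by
      intro x y
      conv_lhs => rw [← b.sum_repr x, ← b.sum_repr y]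
      simp only [map_sum, map_smul, Finset.sum_mul, Finset.mul_sum, smul_mul_smul_comm]
      rw [Finset.sum_comm]
    have hanti : ExteriorAlgebra.ι F (v 1) * ExteriorAlgebra.ι F (v 0) =
        - (ExteriorAlgebra.ι F (v 0) * ExteriorAlgebra.ι F (v 1)) :=
      eq_neg_of_add_eq_zero_left (ExteriorAlgebra.ι_add_mul_swap _ _)
    have : (2 : F) • (ExteriorAlgebra.ι F (v 0) * ExteriorAlgebra.ι F (v 1)) =
        ExteriorAlgebra.ι F (v 0) * ExteriorAlgebra.ι F (v 1) -
        ExteriorAlgebra.ι F (v 1) * ExteriorAlgebra.ι F (v 0) := by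
      rw [hanti, two_smul]; abel
    rw [this, hexp, hexp (v 1)]
    simp only [← Finset.sum_sub_distrib, ← sub_smul, Matrix.sub_apply, Matrix.vecMulVec_apply]
  | zero => simp
  | add x y _ _ hx hy =>
    rw [smul_add, hx, hy]
    simp only [map_add, Matrix.add_apply, add_smul, Finset.sum_add_distrib]
  | smul a x _ hx =>
    rw [smul_comm, hx]
    simp only [map_smul, Matrix.smul_apply, Finset.smul_sum, smul_smul, smul_eq_mul]

lemma coord2_inj {F M : Type*} [Field F] [CharZero F] [AddCommGroup M] [Module F M] {m : ℕ}
    (b : Module.Basis (Fin m) F M) (x y : ExteriorAlgebra F M) (hx : x ∈ ⋀[F]^2 M)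
    (hy : y ∈ ⋀[F]^2 M) (h : coord2 b x = coord2 b y) : x = y := by
  have h1 := coord2_recon b x hx
  rw [h, ← coord2_recon b y hy] at h1
  exact smul_right_injective _ (two_ne_zero (α := F)) h1

lemma coord2_theta (V : Type) [AddCommGroup V] [Module ℚ V]
    [Algebra ℚ (ExteriorAlgebra ℂ (ℂ ⊗[ℚ] V))]
    [IsScalarTower ℚ ℂ (ExteriorAlgebra ℂ (ℂ ⊗[ℚ] V))] {m : ℕ}
    (b : Module.Basis (Fin m) ℚ V) (x : ExteriorAlgebra ℚ V) (hx : x ∈ ⋀[ℚ]^2 V) :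
    coord2 (Algebra.TensorProduct.basis ℂ b) (thetaA V x) =
      (algebraMap ℚ ℂ).mapMatrix (coord2 b x) := by
  rw [← ExteriorAlgebra.ιMulti_span_fixedDegree] at hx
  induction hx using Submodule.span_induction with
  | mem x h =>
    obtain ⟨v, rfl⟩ := h
    have h1 : ∀ w : V, thetaA V (ExteriorAlgebra.ι ℚ w) =
        ExteriorAlgebra.ι ℂ ((1 : ℂ) ⊗ₜ[ℚ] w) := by
      intro w
      exact ExteriorAlgebra.lift_ι_apply ℚ _ _ w
    have h2 : thetaA V (ExteriorAlgebra.ιMulti ℚ 2 v) =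
        ExteriorAlgebra.ιMulti ℂ 2 (fun i => (1 : ℂ) ⊗ₜ[ℚ] v i) := by
      rw [iotaMulti_two, map_mul, h1, h1, iotaMulti_two]
    rw [h2, coord2_apply, coord2_apply]
    ext i j
    simp [Matrix.vecMulVec_apply]
  | zero => simp
  | add x y _ _ hx hy => rw [map_add, map_add, hx, hy, map_add, map_add]
  | smul a x _ hx =>
    let g : ExteriorAlgebra ℚ V →+ Matrix (Fin m) (Fin m) ℂ :=
      (coord2 (Algebra.TensorProduct.basis ℂ b)).toAddMonoidHom.comp
        ((thetaA V : ExteriorAlgebra ℚ V →+* ExteriorAlgebra ℂ (ℂ ⊗[ℚ] V)) :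
          ExteriorAlgebra ℚ V →+ ExteriorAlgebra ℂ (ℂ ⊗[ℚ] V))
    have h1 : g (a • x) = a • g x := map_rat_smul g a x
    have h2 : g x = (algebraMap ℚ ℂ).mapMatrix (coord2 b x) := hx
    change g (a • x) = _
    rw [h1, h2, map_smul]
    ext i j
    simp [Rat.smul_def]

/-- `c(W)` as a complex subspace. -/
def conjSubC (V : Type) [AddCommGroup V] [Module ℚ V] (W : Submodule ℂ (ℂ ⊗[ℚ] V)) :
    Submodule ℂ (ℂ ⊗[ℚ] V) where
  carrier := conjSub V W
  add_mem' := (conjSub V W).add_mem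
  zero_mem' := (conjSub V W).zero_mem
  smul_mem' z x hx := by
    obtain ⟨w, hw, rfl⟩ := hx
    refine ⟨(starRingEnd ℂ z) • w, W.smul_mem _ hw, ?_⟩
    clear hw
    induction w using TensorProduct.induction_on with
    | zero => simp
    | add x y hx hy => rw [smul_add, map_add, map_add, hx, hy, smul_add]
    | tmul a v => simp [conjV, TensorProduct.smul_tmul']

lemma conjV_baseChange (V : Type) [AddCommGroup V] [Module ℚ V] (φ : V →ₗ[ℚ] V)
    (x : ℂ ⊗[ℚ] V) : LinearMap.baseChange ℂ φ (conjV V x) = conjV V (LinearMap.baseChange ℂ φ x) := by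
  induction x using TensorProduct.induction_on with
  | zero => simp
  | add x y hx hy => simp only [map_add, hx, hy]
  | tmul a v => simp [conjV]

lemma eigen_split {U : Type*} [AddCommGroup U] [Module ℂ U] {m : ℕ} (f : U →ₗ[ℂ] U)
    (lam : Fin m → ℂ) (hinj : Function.Injective lam) (e : Module.Basis (Fin m) ℂ U)
    (he : ∀ i, f (e i) = lam i • e i) (W W' : Submodule ℂ U)
    (hW : ∀ x ∈ W, f x ∈ W) (hW' : ∀ x ∈ W', f x ∈ W') (hc : IsCompl W W') :
    ∃ S : Finset (Fin m), (∀ i ∈ S, e i ∈ W) ∧ (∀ i, i ∉ S → e i ∈ W') ∧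
      (∀ x ∈ W, ∀ i, i ∉ S → e.repr x i = 0) ∧ (∀ x ∈ W', ∀ i ∈ S, e.repr x i = 0) := by
  classical
  have hfrepr : ∀ x i, e.repr (f x) i = lam i * e.repr x i := by
    intro x i
    conv_lhs => rw [← e.sum_repr x]
    simp only [map_sum, map_smul, he, smul_smul]
    simp [Finsupp.single_apply, mul_comm]
  have heig : ∀ x i, f x = lam i • x → x = e.repr x i • e i := by
    intro x i hx
    apply e.repr.injective
    ext j
    have h1 := hfrepr x j
    rw [hx] at h1
    simp only [map_smul, Finsupp.smul_apply, smul_eq_mul, Module.Basis.repr_self,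
      Finsupp.single_apply, mul_ite, mul_one, mul_zero] at h1 ⊢
    split_ifs with h
    · rw [h]
    · have h2 : (lam i - lam j) * e.repr x j = 0 := by rw [sub_mul, h1, sub_self]
      exact (mul_eq_zero.1 h2).resolve_left (sub_ne_zero.2 fun h' => h (hinj h'))
  have hor : ∀ i, e i ∈ W ∨ e i ∈ W' := by
    intro i
    obtain ⟨w, hw, w', hw', hs⟩ := Submodule.mem_sup.1
      (show e i ∈ W ⊔ W' by rw [hc.sup_eq_top]; trivial)
    have h1 : f w - lam i • w ∈ W := W.sub_mem (hW w hw) (W.smul_mem _ hw)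
    have h2 : f w - lam i • w = -(f w' - lam i • w') := by
      have := he i
      rw [← hs, map_add, smul_add] at this
      rw [neg_sub, sub_eq_sub_iff_add_eq_add, this]; abel
    have h3 : f w - lam i • w ∈ W' := by
      rw [h2]; exact W'.neg_mem (W'.sub_mem (hW' w' hw') (W'.smul_mem _ hw'))
    have h4 : f w - lam i • w = 0 := Submodule.disjoint_def.1 hc.disjoint _ h1 h3
    have h5 := heig w i (sub_eq_zero.1 h4)
    by_cases ha : e.repr w i = 0
    · right
      rw [ha, zero_smul] at h5
      rw [← hs, h5, zero_add]; exact hw'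
    · left
      have : e i = (e.repr w i)⁻¹ • w := by
        conv_rhs => rw [h5]
        simp [smul_smul, ha]
      rw [this]; exact W.smul_mem _ hw
  let S : Finset (Fin m) := Finset.univ.filter (fun i => e i ∈ W)
  have hS1 : ∀ i ∈ S, e i ∈ W := fun i hi => (Finset.mem_filter.1 hi).2
  have hS2 : ∀ i, i ∉ S → e i ∈ W' := fun i hi =>
    (hor i).resolve_left fun h => hi (Finset.mem_filter.2 ⟨Finset.mem_univ _, h⟩)
  have hdec : ∀ x, x = ∑ i ∈ S, e.repr x i • e i + ∑ i ∈ Sᶜ, e.repr x i • e i := by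
    intro x
    rw [Finset.sum_add_sum_compl, e.sum_repr]
  have hin : ∀ x, ∑ i ∈ S, e.repr x i • e i ∈ W := fun x =>
    W.sum_mem fun i hi => W.smul_mem _ (hS1 i hi)
  have hin' : ∀ x, ∑ i ∈ Sᶜ, e.repr x i • e i ∈ W' := fun x =>
    W'.sum_mem fun i hi => W'.smul_mem _ (hS2 i (Finset.mem_compl.1 hi))
  have hz : ∀ (T : Finset (Fin m)) (x : U), ∑ i ∈ T, e.repr x i • e i = 0 →
      ∀ i ∈ T, e.repr x i = 0 := by
    intro T x h
    exact linearIndependent_iff'.1 e.linearIndependent T _ h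
  refine ⟨S, hS1, hS2, fun x hx i hi => ?_, fun x hx i hi => ?_⟩
  · refine hz Sᶜ x ?_ i (Finset.mem_compl.2 hi)
    refine Submodule.disjoint_def.1 hc.disjoint _ ?_ (hin' x)
    have : ∑ i ∈ Sᶜ, e.repr x i • e i = x - ∑ i ∈ S, e.repr x i • e i :=
      eq_sub_of_add_eq' (hdec x).symm
    rw [this]; exact W.sub_mem hx (hin x)
  · refine hz S x ?_ i hi
    refine Submodule.disjoint_def.1 hc.disjoint _ (hin x) ?_
    have : ∑ i ∈ S, e.repr x i • e i = x - ∑ i ∈ Sᶜ, e.repr x i • e i :=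
      eq_sub_of_add_eq (hdec x).symm
    rw [this]; exact W'.sub_mem hx (hin' x)

/-- Under condition (*) (`n ≥ 4`), the weight-2 Hodge structure on `⋀²V` is
simple: every `ℚ`-subspace `H ⊆ ⋀²V` such that `ℂ ⊗ H` is the direct sum of its intersections
with the `(2,0)`-, `(1,1)`- and `(0,2)`-components of `⋀²(ℂ ⊗ V)` is `0` or all of `⋀²V`. -/
theorem wedge_two_hodge_structure_simple
    (n : ℕ) (hn : 4 ≤ n)
    (V : Type) [AddCommGroup V] [Module ℚ V] [FiniteDimensional ℚ V]
    (hdim : Module.finrank ℚ V = 2 * n)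
    (φ : V →ₗ[ℚ] V)
    (lam : Fin (2 * n) → ℂ) (hinj : Function.Injective lam)
    (hroot : ∀ i, Polynomial.aeval (lam i) (LinearMap.charpoly φ) = 0)
    (hgal : galoisActsFully (2 * n) lam)
    (W : Submodule ℂ (ℂ ⊗[ℚ] V))
    (hWdim : Module.finrank ℂ W = n)
    (hWinv : ∀ x ∈ W, LinearMap.baseChange ℂ φ x ∈ W)
    (hWsup : W.restrictScalars ℚ ⊔ conjSub V W = ⊤)
    (hWinf : W.restrictScalars ℚ ⊓ conjSub V W = ⊥)
    [Algebra ℚ (ExteriorAlgebra ℂ (ℂ ⊗[ℚ] V))]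
    [IsScalarTower ℚ ℂ (ExteriorAlgebra ℂ (ℂ ⊗[ℚ] V))]
    (H : Submodule ℚ (ExteriorAlgebra ℚ V)) (hH : H ≤ ⋀[ℚ]^2 V)
    (hHdecomp : Submodule.span ℂ (⇑(thetaA V) '' H) =
      ⨆ p : Fin 3, (Submodule.span ℂ (⇑(thetaA V) '' H) ⊓ hodgeComp V W 2 p)) :
    H = ⊥ ∨ H = ⋀[ℚ]^2 V := by
  classical
  let b : Module.Basis (Fin (2 * n)) ℚ V := Module.finBasisOfFinrankEq ℚ V hdim
  let bC : Module.Basis (Fin (2 * n)) ℂ (ℂ ⊗[ℚ] V) := Algebra.TensorProduct.basis ℂ b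
  have hdimC : Module.finrank ℂ (ℂ ⊗[ℚ] V) = 2 * n := by
    rw [Module.finrank_baseChange, hdim]
  let f := LinearMap.baseChange ℂ φ
  have hev : ∀ i, ∃ v, Module.End.HasEigenvector f (lam i) v := by
    intro i
    apply Module.End.HasEigenvalue.exists_hasEigenvector
    rw [Module.End.hasEigenvalue_iff_isRoot_charpoly, LinearMap.charpoly_baseChange,
      Polynomial.IsRoot, Polynomial.eval_map_algebraMap]
    exact hroot i
  choose ev hev using hev
  have hli : LinearIndependent ℂ ev :=
    Module.End.eigenvectors_linearIndependent' f lam hinj ev hev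
  have : Nonempty (Fin (2 * n)) := ⟨⟨0, by omega⟩⟩
  let e : Module.Basis (Fin (2 * n)) ℂ (ℂ ⊗[ℚ] V) :=
    basisOfLinearIndependentOfCardEqFinrank hli (by simp [hdimC])
  have he : ∀ i, f (e i) = lam i • e i := by
    intro i
    simp only [e, coe_basisOfLinearIndependentOfCardEqFinrank]
    exact (hev i).apply_eq_smul
  have hW'inv : ∀ x ∈ conjSubC V W, f x ∈ conjSubC V W := by
    rintro _ ⟨w, hw, rfl⟩
    exact ⟨f w, hWinv w hw, (conjV_baseChange V φ w).symm⟩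
  have hcompl : IsCompl W (conjSubC V W) := by
    constructor
    · rw [Submodule.disjoint_def]
      intro x hx hx'
      have : x ∈ W.restrictScalars ℚ ⊓ conjSub V W := ⟨hx, hx'⟩
      rw [hWinf] at this
      exact this
    · rw [codisjoint_iff, eq_top_iff]
      intro x _
      have : x ∈ W.restrictScalars ℚ ⊔ conjSub V W := by rw [hWsup]; trivial
      obtain ⟨y, hy, z, hz, rfl⟩ := Submodule.mem_sup.1 this
      exact Submodule.mem_sup.2 ⟨y, hy, z, hz, rfl⟩
  obtain ⟨S, hS1, hS2, hS3, hS4⟩ := eigen_split f lam hinj e he W (conjSubC V W) hWinv hW'inv hcompl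
  have hSne : S.Nonempty := by
    rw [Finset.nonempty_iff_ne_empty]
    rintro rfl
    have : W = ⊥ := by
      rw [eq_bot_iff]
      intro x hx
      have : e.repr x = 0 := by
        ext i
        exact hS3 x hx i (Finset.notMem_empty i)
      simpa using this
    rw [this, finrank_bot] at hWdim
    omega
  have hSne' : ∃ j, j ∉ S := by
    by_contra hcon
    push Not at hcon
    have : W = ⊤ := by
      rw [eq_top_iff, ← e.span_eq, Submodule.span_le]
      rintro _ ⟨i, rfl⟩
      exact hS1 i (hcon i)
    rw [this, finrank_top, hdimC] at hWdim
    omega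
  let E := bC.toMatrix e
  let E' := e.toMatrix bC
  let G := E * Matrix.diagonal (fun i => if i ∈ S then (1 : ℂ) else 0) * E'
  have hGW : ∀ x ∈ W, G.mulVec (bC.repr x) = (1 : ℂ) • (bC.repr x : Fin (2 * n) → ℂ) := by
    intro x hx
    have h1 : (Matrix.diagonal (fun i => if i ∈ S then (1 : ℂ) else 0)).mulVec (e.repr x) =
        e.repr x := by
      ext i
      rw [Matrix.mulVec_diagonal]
      by_cases hi : i ∈ S
      · simp [hi]
      · simp [hi, hS3 x hx i hi]
    simp only [G, ← Matrix.mulVec_mulVec]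
    rw [Module.Basis.toMatrix_mulVec_repr, h1, Module.Basis.toMatrix_mulVec_repr, one_smul]
  have hGW' : ∀ x ∈ conjSub V W, G.mulVec (bC.repr x) =
      (0 : ℂ) • (bC.repr x : Fin (2 * n) → ℂ) := by
    intro x hx
    have h1 : (Matrix.diagonal (fun i => if i ∈ S then (1 : ℂ) else 0)).mulVec (e.repr x) = 0 := by
      ext i
      rw [Matrix.mulVec_diagonal]
      by_cases hi : i ∈ S
      · simp [hi, hS4 x hx i hi]
      · simp [hi]
    simp only [G, ← Matrix.mulVec_mulVec]
    rw [Module.Basis.toMatrix_mulVec_repr, h1, Matrix.mulVec_zero, zero_smul]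
  have hD : ∀ (ε δ : ℂ) (x y : Fin (2 * n) → ℂ), G.mulVec x = ε • x → G.mulVec y = δ • y →
      G * (Matrix.vecMulVec x y - Matrix.vecMulVec y x) +
        (Matrix.vecMulVec x y - Matrix.vecMulVec y x) * G.transpose =
      (ε + δ) • (Matrix.vecMulVec x y - Matrix.vecMulVec y x) := by
    intro ε δ x y hx hy
    rw [Matrix.mul_sub, Matrix.sub_mul, Matrix.mul_vecMulVec, Matrix.mul_vecMulVec,
      Matrix.vecMulVec_mul, Matrix.vecMulVec_mul, Matrix.vecMul_transpose, Matrix.vecMul_transpose,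
      hx, hy]
    ext i j
    simp [Matrix.vecMulVec_apply]
    ring
  have hhodge : ∀ (p : Fin 3), ∀ z ∈ hodgeComp V W 2 p,
      G * coord2 bC z + coord2 bC z * G.transpose = ((p : ℕ) : ℂ) • coord2 bC z := by
    intro p z hz
    induction hz using Submodule.span_induction with
    | mem z h =>
      obtain ⟨v, hv, rfl⟩ := h
      rw [coord2_apply]
      have h0 := hv 0
      have h1 := hv 1
      fin_cases p
      · rw [hD 0 0 _ _ (hGW' _ (h0.2 (by simp))) (hGW' _ (h1.2 (by simp)))]
        simp
      · rw [hD 1 0 _ _ (hGW _ (h0.1 (by simp))) (hGW' _ (h1.2 (by simp)))]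
        simp
      · rw [hD 1 1 _ _ (hGW _ (h0.1 (by simp))) (hGW _ (h1.1 (by simp)))]
        norm_num
    | zero => simp
    | add x y _ _ hx hy =>
      rw [map_add, Matrix.mul_add, Matrix.add_mul, smul_add, ← hx, ← hy]; abel
    | smul a x _ hx =>
      rw [map_smul, Matrix.mul_smul, Matrix.smul_mul, ← smul_add, hx, smul_comm]
  let H' : Submodule ℚ (Matrix (Fin (2 * n)) (Fin (2 * n)) ℚ) := H.map (coord2 b)
  set HC := Submodule.span ℂ (⇑(thetaA V) '' (H : Set (ExteriorAlgebra ℚ V))) with hHC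
  have hspan : ∀ z ∈ HC, coord2 bC z ∈ Submodule.span ℂ ((algebraMap ℚ ℂ).mapMatrix ''
      (H' : Set (Matrix (Fin (2 * n)) (Fin (2 * n)) ℚ))) := by
    intro z hz
    have : HC ≤ (Submodule.span ℂ ((algebraMap ℚ ℂ).mapMatrix ''
      (H' : Set (Matrix (Fin (2 * n)) (Fin (2 * n)) ℚ)))).comap (coord2 bC) := by
      rw [hHC, Submodule.span_le]
      rintro _ ⟨h, hh, rfl⟩
      refine Submodule.subset_span ⟨coord2 b h, ⟨h, hh, rfl⟩, ?_⟩
      exact (coord2_theta V b h (hH hh)).symm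
    exact this hz
  have hstabC : ∀ z ∈ HC, G * coord2 bC z + coord2 bC z * G.transpose ∈
      Submodule.span ℂ ((algebraMap ℚ ℂ).mapMatrix ''
      (H' : Set (Matrix (Fin (2 * n)) (Fin (2 * n)) ℚ))) := by
    intro z hz
    rw [hHdecomp] at hz
    induction hz using Submodule.iSup_induction' with
    | mem p x hx =>
      rw [hhodge p x hx.2]
      exact Submodule.smul_mem _ _ (hspan x hx.1)
    | zero => simp
    | add x y _ _ hx hy =>
      have : G * coord2 bC (x + y) + coord2 bC (x + y) * G.transpose =
        (G * coord2 bC x + coord2 bC x * G.transpose) +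
        (G * coord2 bC y + coord2 bC y * G.transpose) := by
        rw [map_add, Matrix.mul_add, Matrix.add_mul]; abel
      rw [this]
      exact Submodule.add_mem _ hx hy
  have hdiag : (algebraMap ℚ ℂ).mapMatrix (LinearMap.toMatrix b b φ) * E =
      E * Matrix.diagonal lam := by
    have h1 : (algebraMap ℚ ℂ).mapMatrix (LinearMap.toMatrix b b φ) = LinearMap.toMatrix bC bC f :=
      (LinearMap.toMatrix_baseChange ℂ φ b b).symm
    rw [h1]
    ext a i
    have h2 : (LinearMap.toMatrix bC bC f * E) a i =
        (LinearMap.toMatrix bC bC f).mulVec (bC.repr (e i)) a := rfl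
    rw [h2, LinearMap.toMatrix_mulVec_repr, he, Matrix.mul_diagonal]
    simp [E, Module.Basis.toMatrix_apply, mul_comm]
  have hcore := matrix_core (2 * n) (LinearMap.toMatrix b b φ) lam hinj hgal E E'
    (bC.toMatrix_mul_toMatrix_flip e) (e.toMatrix_mul_toMatrix_flip bC) hdiag S hSne hSne' H'
    (by
      rintro _ ⟨h, hh, rfl⟩
      exact coord2_skew b h (hH hh))
    (by
      rintro _ ⟨h, hh, rfl⟩
      have := hstabC (thetaA V h) (Submodule.subset_span ⟨h, hh, rfl⟩)
      rw [coord2_theta V b h (hH hh)] at this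
      exact this)
  rcases hcore with h0 | h1
  · left
    rw [eq_bot_iff]
    intro x hx
    have h2 : coord2 b x ∈ H' := ⟨x, hx, rfl⟩
    rw [h0, Submodule.mem_bot] at h2
    exact coord2_inj b x 0 (hH hx) (Submodule.zero_mem _) (by rw [h2, map_zero])
  · right
    refine le_antisymm hH fun x hx => ?_
    obtain ⟨y, hy, hxy⟩ := h1 _ (coord2_skew b x hx)
    rw [← coord2_inj b y x (hH hy) hx hxy]
    exact hy

end VoisinPaper
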